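/- arXiv:2508.00004 — 2 statements merged into one kernel-verified Lean document; each statement's English description precedes it below -/
import Mathlib

section
/- Let M = (D, I, Σ, ∼) be a k-sight model, σ1 ∈ Σ, α ∈ L_B, and z ∈ {x,y}. Then M,σ1 ⊨ ⋀_{T⊆Cons}(Rz=T → ⋀_{c∈T} α[c/z]) if and only if for all σ2 with R^z σ1 σ2 it holds that M',σ2 ⊨ α, where M' = (D, I, Σ', ∼') is the update of M associated to σ2 induced by [z]. Equivalently, the schema [z]α ↔ ⋀_{T⊆Cons}(Rz=T → ⋀_{c∈T} α[c/z]) for α ∈ L_B is valid on k-sight models. -/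
/-! Core definitions for the Epistemic Logic of Cops and Robbers (ELCR). -/

/-- The two players/variables. -/
inductive Var : Type
  | x | y
  deriving DecidableEq

/-- The other variable. -/
def Var.other : Var → Var
  | .x => .y
  | .y => .x

/-- Terms: constants or variables. -/
inductive Term (Cons : Type) : Type
  | const (c : Cons)
  | var (v : Var)
  deriving DecidableEq

/-- Formulas of the full language `L` (with movement modalities). -/
inductive Form (Pred Cons : Type) : Type
  | pred (P : Pred) (args : List (Term Cons))
  | rel (t₁ t₂ : Term Cons)
  | eq (t₁ t₂ : Term Cons)
  | neg (φ : Form Pred Cons)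
  | and (φ ψ : Form Pred Cons)
  | Kt (z : Var) (t : Term Cons)
  | K (z : Var) (φ : Form Pred Cons)
  | box (z : Var) (φ : Form Pred Cons)

namespace Form

variable {Pred Cons : Type}

def imp (φ ψ : Form Pred Cons) : Form Pred Cons := .neg (.and φ (.neg ψ))
def or (φ ψ : Form Pred Cons) : Form Pred Cons := .neg (.and (.neg φ) (.neg ψ))
def iffF (φ ψ : Form Pred Cons) : Form Pred Cons := .and (imp φ ψ) (imp ψ φ)
def falseF : Form Pred Cons := .neg (.eq (.var .x) (.var .x))
def trueF : Form Pred Cons := .neg falseF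
/-- `⟨K_z⟩φ := ¬K_z¬φ`. -/
def diaK (z : Var) (φ : Form Pred Cons) : Form Pred Cons := .neg (.K z (.neg φ))

def bigAnd : List (Form Pred Cons) → Form Pred Cons
  | [] => trueF
  | φ :: l => .and φ (bigAnd l)

def bigOr : List (Form Pred Cons) → Form Pred Cons
  | [] => falseF
  | φ :: l => or φ (bigOr l)

/-- Membership in the Boolean base language `L_B`. -/
def isBase : Form Pred Cons → Prop
  | .pred _ _ => True
  | .rel _ _ => True
  | .eq _ _ => True
  | .neg φ => isBase φ
  | .and φ ψ => isBase φ ∧ isBase ψ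
  | .Kt _ _ => False
  | .K _ _ => False
  | .box _ _ => False

/-- Membership in `L_BD` (Booleans plus movement modalities). -/
def isBD : Form Pred Cons → Prop
  | .pred _ _ => True
  | .rel _ _ => True
  | .eq _ _ => True
  | .neg φ => isBD φ
  | .and φ ψ => isBD φ ∧ isBD ψ
  | .Kt _ _ => False
  | .K _ _ => False
  | .box _ φ => isBD φ

/-- Membership in the full language `L`. -/
def isL : Form Pred Cons → Prop
  | .pred _ _ => True
  | .rel _ _ => True
  | .eq _ _ => True
  | .neg φ => isL φ
  | .and φ ψ => isL φ ∧ isL ψ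
  | .Kt _ _ => True
  | .K _ ψ => isBD ψ
  | .box _ φ => isL φ

/-- Membership in the static fragment `L⁻`: no movement modalities, and the
knowledge operator `K_z` is applied to `L_B`-formulas only. -/
def isStatic : Form Pred Cons → Prop
  | .pred _ _ => True
  | .rel _ _ => True
  | .eq _ _ => True
  | .neg φ => isStatic φ
  | .and φ ψ => isStatic φ ∧ isStatic ψ
  | .Kt _ _ => True
  | .K _ φ => isBase φ
  | .box _ _ => False

/-- The variable `z` occurs in the formula. -/
def occurs (z : Var) : Form Pred Cons → Prop
  | .pred _ args => Term.var z ∈ args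
  | .rel t₁ t₂ => t₁ = Term.var z ∨ t₂ = Term.var z
  | .eq t₁ t₂ => t₁ = Term.var z ∨ t₂ = Term.var z
  | .neg φ => occurs z φ
  | .and φ ψ => occurs z φ ∨ occurs z ψ
  | .Kt w t => w = z ∨ t = Term.var z
  | .K w φ => w = z ∨ occurs z φ
  | .box w φ => w = z ∨ occurs z φ

/-- The list of terms occurring in a formula. -/
def termList : Form Pred Cons → List (Term Cons)
  | .pred _ args => args
  | .rel t₁ t₂ => [t₁, t₂]
  | .eq t₁ t₂ => [t₁, t₂]
  | .neg φ => termList φ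
  | .and φ ψ => termList φ ++ termList ψ
  | .Kt _ t => [t]
  | .K _ φ => termList φ
  | .box _ φ => termList φ

end Form

/-- Substituting the constant `c` for the variable `z` in a term. -/
def Term.substC {Cons : Type} (c : Cons) (z : Var) : Term Cons → Term Cons
  | .var v => if v = z then .const c else .var v
  | .const c' => .const c'

/-- `φ.substC c z` is `φ[c/z]`. -/
def Form.substC {Pred Cons : Type} (c : Cons) (z : Var) : Form Pred Cons → Form Pred Cons
  | .pred P args => .pred P (args.map (Term.substC c z))
  | .rel t₁ t₂ => .rel (t₁.substC c z) (t₂.substC c z)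
  | .eq t₁ t₂ => .eq (t₁.substC c z) (t₂.substC c z)
  | .neg φ => .neg (φ.substC c z)
  | .and φ ψ => .and (φ.substC c z) (ψ.substC c z)
  | .Kt w t => .Kt w (t.substC c z)
  | .K w φ => .K w (φ.substC c z)
  | .box w φ => .box w (φ.substC c z)

/-- Replacing the term `t₂` by the term `t₁`. -/
def Term.repl {Cons : Type} [DecidableEq Cons] (t₁ t₂ t : Term Cons) : Term Cons :=
  if t = t₂ then t₁ else t

/-- `φ.replace t₁ t₂` is `φ[t₁/t₂]`: the result of replacing `t₂` in `φ` with `t₁`. -/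
def Form.replace {Pred Cons : Type} [DecidableEq Cons] (t₁ t₂ : Term Cons) :
    Form Pred Cons → Form Pred Cons
  | .pred P args => .pred P (args.map (Term.repl t₁ t₂))
  | .rel s₁ s₂ => .rel (Term.repl t₁ t₂ s₁) (Term.repl t₁ t₂ s₂)
  | .eq s₁ s₂ => .eq (Term.repl t₁ t₂ s₁) (Term.repl t₁ t₂ s₂)
  | .neg φ => .neg (φ.replace t₁ t₂)
  | .and φ ψ => .and (φ.replace t₁ t₂) (ψ.replace t₁ t₂)
  | .Kt w t => .Kt w (Term.repl t₁ t₂ t)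
  | .K w φ => .K w (φ.replace t₁ t₂)
  | .box w φ => .box w (φ.replace t₁ t₂)

/-- The list of all terms (constants and variables), for finite `Cons`. -/
noncomputable def allTerms (Cons : Type) [Fintype Cons] : List (Term Cons) :=
  (Finset.univ : Finset Cons).toList.map Term.const ++ [Term.var .x, Term.var .y]

/-- The syntactic distance formulas `D^n t₁ t₂`. -/
noncomputable def distForm (Pred : Type) {Cons : Type} [Fintype Cons] :
    ℕ → Term Cons → Term Cons → Form Pred Cons
  | 0, t₁, t₂ => .eq t₁ t₂
  | n + 1, t₁, t₂ =>
      Form.or (distForm Pred n t₁ t₂)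
        (Form.bigOr ((allTerms Cons).map fun t =>
          Form.and (distForm Pred n t₁ t) (Form.or (.rel t t₂) (.rel t₂ t))))

/-- `K_z z' = T`: the set `T` consists of the possible positions of `z'` considered by `z`. -/
noncomputable def KzEqSet {Pred Cons : Type} [Fintype Cons] [DecidableEq Cons]
    (z z' : Var) (T : Finset Cons) : Form Pred Cons :=
  Form.bigAnd
    ((T.toList.map fun c => Form.diaK z (.eq (.var z') (.const c))) ++
      (Tᶜ.toList.map fun c => Form.K z (.neg (.eq (.var z') (.const c)))))

/-- `Rz = T`: `T` is exactly the set of (names of) R-successors of `z`. -/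
noncomputable def RzEqSet {Pred Cons : Type} [Fintype Cons] [DecidableEq Cons]
    (z : Var) (T : Finset Cons) : Form Pred Cons :=
  Form.bigAnd
    ((T.toList.map fun c => Form.rel (.var z) (.const c)) ++
      (Tᶜ.toList.map fun c => Form.neg (Form.rel (.var z) (.const c))))

/-- The list of all subsets of `Cons`. -/
noncomputable def powList (Cons : Type) [Fintype Cons] [DecidableEq Cons] : List (Finset Cons) :=
  (Finset.univ : Finset Cons).powerset.toList

/-! ### Semantics -/

/-- An interpretation of the vocabulary over a domain `D`. -/
structure Interp (Pred Cons D : Type) where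
  pred : Pred → List D → Prop
  rel : D → D → Prop
  const : Cons → D

/-- Assignments (situations): positions of the two players. -/
abbrev Assign (D : Type) := Var → D

/-- The value of a term at an interpretation and a situation. -/
def Term.val {Pred Cons D : Type} (I : Interp Pred Cons D) (σ : Assign D) :
    Term Cons → D
  | .const c => I.const c
  | .var v => σ v

/-- `Dball I m s` is `D^m(s)`: points reachable from `s` in at most `m` steps
along `I.rel` or its converse. -/
def Dball {Pred Cons D : Type} (I : Interp Pred Cons D) : ℕ → D → Set D
  | 0, s => {s}
  | m + 1, s => Dball I m s ∪ {t | ∃ u ∈ Dball I m s, I.rel u t ∨ I.rel t u}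

/-- `R^z σ σ'`: player `z` moves along an arrow, the other player stays put. -/
def Rstep {Pred Cons D : Type} (I : Interp Pred Cons D) (z : Var) (σ σ' : Assign D) : Prop :=
  I.rel (σ z) (σ' z) ∧ σ z.other = σ' z.other

/-- Indistinguishability data: a relation on assignments for each player. -/
abbrev SimRel (D : Type) := Var → Assign D → Assign D → Prop

/-- `Σ|σ`: the situations related to `σ` by some player's indistinguishability. -/
def restrict {D : Type} (Sit : Set (Assign D)) (sim : SimRel D) (σ : Assign D) :
    Set (Assign D) :=
  {σ' ∈ Sit | ∃ z, sim z σ σ'}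

/-- The updated set of situations after player `z` moves from `σ₁` to `σ₂`. -/
def updSit {Pred Cons D : Type} (k : ℕ) (I : Interp Pred Cons D)
    (Sit : Set (Assign D)) (sim : SimRel D) (z : Var) (σ₁ σ₂ : Assign D) :
    Set (Assign D) :=
  {σ' | (σ₂ Var.x ∈ Dball I k (σ₂ Var.y) ∧ σ' = σ₂) ∨
        (σ₂ Var.x ∉ Dball I k (σ₂ Var.y) ∧
          (∃ σ ∈ restrict Sit sim σ₁, Rstep I z σ σ') ∧
          σ' Var.x ∉ Dball I k (σ' Var.y))}

/-- The updated indistinguishability relations: `σ₁ ∼'_z σ₂` iff `σ₁ z = σ₂ z`. -/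
def updSim (D : Type) : SimRel D := fun z σ₁ σ₂ => σ₁ z = σ₂ z

/-- Satisfaction for `ELCR` (with sight `k`). -/
def Sat {Pred Cons D : Type} (k : ℕ) (I : Interp Pred Cons D) :
    Set (Assign D) → SimRel D → Assign D → Form Pred Cons → Prop
  | _, _, σ, .pred P args => I.pred P (args.map (Term.val I σ))
  | _, _, σ, .rel t₁ t₂ => I.rel (t₁.val I σ) (t₂.val I σ)
  | _, _, σ, .eq t₁ t₂ => t₁.val I σ = t₂.val I σ
  | Sit, sim, σ, .neg φ => ¬ Sat k I Sit sim σ φ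
  | Sit, sim, σ, .and φ ψ => Sat k I Sit sim σ φ ∧ Sat k I Sit sim σ ψ
  | Sit, sim, σ, .Kt z t => ∀ σ' ∈ Sit, sim z σ' σ → t.val I σ = t.val I σ'
  | Sit, sim, σ, .K z φ => ∀ σ' ∈ Sit, sim z σ' σ → Sat k I Sit sim σ' φ
  | Sit, sim, σ, .box z φ => ∀ σ₂, Rstep I z σ σ₂ →
      Sat k I (updSit k I Sit sim z σ σ₂) (updSim D) σ₂ φ

/-- The conditions making `(D, I, Σ, ∼)` a model: seriality of `I.rel`, every
point named by a constant, `Σ` nonempty, and each `∼_z` an equivalence relation on `Σ`. -/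
structure IsModel {Pred Cons D : Type} (I : Interp Pred Cons D)
    (Sit : Set (Assign D)) (sim : SimRel D) : Prop where
  serial : ∀ s, ∃ t, I.rel s t
  const_surj : Function.Surjective I.const
  nonempty : Sit.Nonempty
  sim_mem : ∀ z σ σ', sim z σ σ' → σ ∈ Sit ∧ σ' ∈ Sit
  sim_refl : ∀ z, ∀ σ ∈ Sit, sim z σ σ
  sim_symm : ∀ z σ σ', sim z σ σ' → sim z σ' σ
  sim_trans : ∀ z σ₁ σ₂ σ₃, sim z σ₁ σ₂ → sim z σ₂ σ₃ → sim z σ₁ σ₃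

/-- The `k`-sight condition. -/
def KSight {Pred Cons D : Type} (k : ℕ) (I : Interp Pred Cons D)
    (Sit : Set (Assign D)) (sim : SimRel D) : Prop :=
  ∀ z σ σ', σ ∈ Sit → σ' ∈ Sit → sim z σ σ' →
    ∀ z', σ z' ∈ Dball I k (σ z) → σ z' = σ' z'

/-- A nonempty conjunction `K_zα₁ ∧ ⋯ ∧ K_zαₙ ∧ ⟨K_z⟩β₁ ∧ ⋯ ∧ ⟨K_z⟩βₘ`. -/
def kConj {Pred Cons : Type} (z : Var) (αs βs : List (Form Pred Cons)) :
    Form Pred Cons :=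
  Form.bigAnd (αs.map (Form.K z) ++ βs.map (Form.diaK z))
section Satisfaction

variable {Pred Cons D : Type} {k : ℕ} {I : Interp Pred Cons D}
  {Sit : Set (Assign D)} {sim : SimRel D} {σ : Assign D}

theorem sat_imp {φ ψ : Form Pred Cons} :
    Sat k I Sit sim σ (φ.imp ψ) ↔ (Sat k I Sit sim σ φ → Sat k I Sit sim σ ψ) := by
  simp only [Form.imp, Sat]
  tauto

theorem sat_bigAnd {l : List (Form Pred Cons)} :
    Sat k I Sit sim σ (Form.bigAnd l) ↔ ∀ φ ∈ l, Sat k I Sit sim σ φ := by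
  induction l with
  | nil => simp [Form.bigAnd, Form.trueF, Form.falseF, Sat]
  | cons φ l ih => simp [Form.bigAnd, Sat, ih]

theorem sat_RzEqSet [Fintype Cons] [DecidableEq Cons] {z : Var} {T : Finset Cons} :
    Sat k I Sit sim σ (RzEqSet z T) ↔ ∀ c, c ∈ T ↔ I.rel (σ z) (I.const c) := by
  simp only [RzEqSet, sat_bigAnd, List.mem_append, or_imp, forall_and, List.forall_mem_map,
    Finset.mem_toList, Finset.mem_compl, Sat, Term.val]
  rw [← forall_and]
  exact forall_congr' fun c => ⟨fun h => ⟨h.1, not_imp_not.1 h.2⟩, fun h => ⟨h.1, mt h.2⟩⟩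

theorem Term.val_substC (c : Cons) (z : Var) (t : Term Cons) :
    (t.substC c z).val I σ = t.val I (Function.update σ z (I.const c)) := by
  cases t with
  | const c' => rfl
  | var v =>
    by_cases h : v = z
    · subst h
      simp [Term.substC, Term.val]
    · simp [Term.substC, Term.val, h]

/-- The substitution lemma for `L_B`; the satisfaction of an `L_B`-formula does not depend on the
situations and the indistinguishability relations. -/
theorem sat_substC_iff {φ : Form Pred Cons} (hφ : φ.isBase) (c : Cons) (z : Var)
    (Sit' : Set (Assign D)) (sim' : SimRel D) :
    Sat k I Sit sim σ (φ.substC c z) ↔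
      Sat k I Sit' sim' (Function.update σ z (I.const c)) φ := by
  induction φ with
  | pred P args =>
    simp only [Form.substC, Sat, List.map_map, Function.comp_def, Term.val_substC]
  | rel t₁ t₂ => simp only [Form.substC, Sat, Term.val_substC]
  | eq t₁ t₂ => simp only [Form.substC, Sat, Term.val_substC]
  | neg φ ih => exact not_congr (ih hφ)
  | and φ ψ ihφ ihψ => exact and_congr (ihφ hφ.1) (ihψ hφ.2)
  | Kt => exact hφ.elim
  | K => exact hφ.elim
  | box => exact hφ.elim

theorem rstep_iff_exists_update {z : Var} {σ' : Assign D} :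
    Rstep I z σ σ' ↔ ∃ d, I.rel (σ z) d ∧ σ' = Function.update σ z d := by
  constructor
  · rintro ⟨h, ho⟩
    refine ⟨σ' z, h, funext fun v => ?_⟩
    cases z <;> cases v <;> simp_all [Var.other]
  · rintro ⟨d, h, rfl⟩
    cases z <;> simpa [Rstep, Var.other] using h

end Satisfaction

/-- The effect of updates on `L_B`-formulas: validity of (R1).
`⋀_{T⊆Cons}(Rz=T → ⋀_{c∈T} α[c/z])` holds at `σ₁` iff `α` holds at every `σ₂` with
`R^z σ₁ σ₂` in the updated model; equivalently `[z]α ↔ ⋀_{T⊆Cons}(Rz=T → ⋀_{c∈T} α[c/z])`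
is valid on `k`-sight models. -/
theorem boolean_update_connection {Pred Cons : Type} [Fintype Cons] [DecidableEq Cons]
    [Nonempty Cons] (k : ℕ) (D : Type) [Finite D] (I : Interp Pred Cons D)
    (Sit : Set (Assign D)) (sim : SimRel D)
    (hM : IsModel I Sit sim) (hK : KSight k I Sit sim)
    (σ₁ : Assign D) (hσ : σ₁ ∈ Sit) (α : Form Pred Cons) (hα : α.isBase) (z : Var) :
    (Sat k I Sit sim σ₁
        (Form.bigAnd ((powList Cons).map fun T =>
          (RzEqSet z T).imp (Form.bigAnd (T.toList.map fun c => α.substC c z)))) ↔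
      ∀ σ₂, Rstep I z σ₁ σ₂ →
        Sat k I (updSit k I Sit sim z σ₁ σ₂) (updSim D) σ₂ α) ∧
    (Sat k I Sit sim σ₁ (Form.box z α) ↔
      Sat k I Sit sim σ₁
        (Form.bigAnd ((powList Cons).map fun T =>
          (RzEqSet z T).imp (Form.bigAnd (T.toList.map fun c => α.substC c z))))) := by
  classical
  suffices h : Sat k I Sit sim σ₁
      (Form.bigAnd ((powList Cons).map fun T =>
        (RzEqSet z T).imp (Form.bigAnd (T.toList.map fun c => α.substC c z)))) ↔
      ∀ σ₂, Rstep I z σ₁ σ₂ →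
        Sat k I (updSit k I Sit sim z σ₁ σ₂) (updSim D) σ₂ α from ⟨h, h.symm⟩
  simp only [sat_bigAnd, List.forall_mem_map, sat_imp, sat_RzEqSet, Finset.mem_toList]
  constructor
  · intro h σ₂ hσ₂
    obtain ⟨d, hd, rfl⟩ := rstep_iff_exists_update.1 hσ₂
    obtain ⟨c, rfl⟩ := hM.const_surj d
    exact (sat_substC_iff hα c z _ _).1 <|
      h (Finset.univ.filter fun c => I.rel (σ₁ z) (I.const c)) (by simp [powList])
        (by simp) c (by simpa using hd)
  · intro h T _ hT c hc
    exact (sat_substC_iff hα c z _ _).2 <|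
      h _ (rstep_iff_exists_update.2 ⟨_, (hT c).1 hc, rfl⟩)
end

section
/- Let T ⊆ Cons ∪ Var and let Δ1, Δ2 be maximally consistent sets (MCSs) of L^--formulas such that Δ1 =^Cons Δ2 (Δ1 and Δ2 contain exactly the same L_B-formulas all of whose terms are constants) and Δ1 =_T Δ2 (for every t ∈ T and c ∈ Cons: t≡c ∈ Δ1 iff t≡c ∈ Δ2). Then for every α ∈ L_B all of whose terms occur in T, α ∈ Δ1 iff α ∈ Δ2. -/
/-! ### The proof system ELCR⁻ -/

/-- Evaluation of a formula under a propositional valuation of its non-Boolean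
components: used to define propositional tautologies. -/
def Form.evalProp {Pred Cons : Type} (v : Form Pred Cons → Prop) :
    Form Pred Cons → Prop
  | .neg φ => ¬ Form.evalProp v φ
  | .and φ ψ => Form.evalProp v φ ∧ Form.evalProp v ψ
  | φ => v φ

/-- Propositional tautologies. -/
def Form.Tautology {Pred Cons : Type} (φ : Form Pred Cons) : Prop :=
  ∀ v : Form Pred Cons → Prop, Form.evalProp v φ

/-- The Hilbert-style proof system `ELCR⁻` for the static fragment, with sight `k`. -/
inductive Prov {Pred Cons : Type} [Fintype Cons] [DecidableEq Cons] (k : ℕ) :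
    Form Pred Cons → Prop
  | taut {φ : Form Pred Cons} : φ.isStatic → φ.Tautology → Prov k φ
  | mp {φ ψ : Form Pred Cons} : Prov k (φ.imp ψ) → Prov k φ → Prov k ψ
  | eqRefl (t : Term Cons) : Prov k (.eq t t)
  | eqSymm (t₁ t₂ : Term Cons) : Prov k ((Form.eq t₁ t₂).imp (.eq t₂ t₁))
  | eqTrans (t₁ t₂ t₃ : Term Cons) :
      Prov k (((Form.eq t₁ t₂).and (.eq t₂ t₃)).imp (.eq t₁ t₃))
  | eqSubst {α : Form Pred Cons} (t₁ t₂ : Term Cons) : α.isBase →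
      Prov k ((Form.eq t₁ t₂).imp (α.iffF (α.replace t₁ t₂)))
  | seriality (c : Cons) :
      Prov k (Form.bigOr ((Finset.univ : Finset Cons).toList.map fun t =>
        Form.rel (.const c) (.const t)))
  | atSomewhere (z : Var) :
      Prov k (Form.bigOr ((Finset.univ : Finset Cons).toList.map fun c =>
        Form.eq (.var z) (.const c)))
  | ksight (z : Var) (t : Term Cons) :
      Prov k ((distForm Pred k (.var z) t).imp (.Kt z t))
  | kAx {α β : Form Pred Cons} (z : Var) : α.isBase → β.isBase →
      Prov k ((Form.K z (α.imp β)).imp ((Form.K z α).imp (.K z β)))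
  | tAx {α : Form Pred Cons} (z : Var) : α.isBase →
      Prov k ((Form.K z α).imp α)
  | kGround {α : Form Pred Cons} (z : Var) (T : Finset Cons) : α.isBase →
      Prov k ((KzEqSet z z.other T).imp
        ((Form.K z α).iffF (Form.bigAnd (T.toList.map fun c => α.substC c z.other))))
  | kAdd {α : Form Pred Cons} (z : Var) (αs βs : List (Form Pred Cons)) :
      α.isBase → (∀ γ ∈ αs, γ.isBase) → (∀ γ ∈ βs, γ.isBase) →
      1 ≤ αs.length + βs.length →
      Prov k ((kConj z αs βs).imp α) → Prov k ((kConj z αs βs).imp (.K z α))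
  | kElim {α β : Form Pred Cons} (z : Var) (αs βs : List (Form Pred Cons)) :
      α.isBase → β.isBase → (∀ γ ∈ αs, γ.isBase) → (∀ γ ∈ βs, γ.isBase) →
      1 ≤ αs.length + βs.length →
      Prov k ((kConj z.other αs βs).imp ((Form.K z α).imp β)) →
      Prov k ((kConj z.other αs βs).imp (α.imp β))
  | deRe (z : Var) (t : Term Cons) (c : Cons) :
      Prov k ((Form.eq t (.const c)).imp
        ((Form.Kt z t).iffF (.K z (.eq t (.const c)))))
  | structK {α : Form Pred Cons} (z : Var) (T : Finset (Term Cons)) : α.isBase →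
      (∀ t ∈ α.termList, t ∈ T) →
      Prov k (((Form.bigAnd (T.toList.map (Form.Kt z))).and α).imp (.K z α))

/-- A set of formulas is consistent if no finite conjunction from it proves `⊥`. -/
def consistentS {Pred Cons : Type} [Fintype Cons] [DecidableEq Cons] (k : ℕ)
    (Γ : Set (Form Pred Cons)) : Prop :=
  ¬ ∃ l : List (Form Pred Cons), (∀ φ ∈ l, φ ∈ Γ) ∧
      Prov k ((Form.bigAnd l).imp Form.falseF)

/-- Maximally consistent sets of `L⁻`-formulas. -/
def MCS {Pred Cons : Type} [Fintype Cons] [DecidableEq Cons] (k : ℕ)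
    (Δ : Set (Form Pred Cons)) : Prop :=
  consistentS k Δ ∧ (∀ φ ∈ Δ, Form.isStatic φ) ∧
    ∀ φ : Form Pred Cons, φ.isStatic → φ ∈ Δ ∨ Form.neg φ ∈ Δ

/-- All terms of the formula are constants. -/
def isConsOnly {Pred Cons : Type} (φ : Form Pred Cons) : Prop :=
  ∀ t ∈ φ.termList, ∃ c : Cons, t = Term.const c

/-- `Δ₁ =^Cons Δ₂`: the two sets contain the same `L_B`-formulas whose terms are
all constants. -/
def consEq {Pred Cons : Type} (Δ₁ Δ₂ : Set (Form Pred Cons)) : Prop :=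
  ∀ α : Form Pred Cons, α.isBase → isConsOnly α → (α ∈ Δ₁ ↔ α ∈ Δ₂)

namespace Form

variable {Pred Cons : Type}

theorem evalProp_bigAnd {v : Form Pred Cons → Prop} {l : List (Form Pred Cons)}
    (h : evalProp v (bigAnd l)) : ∀ φ ∈ l, evalProp v φ := by
  induction l with
  | nil => simp
  | cons φ l ih =>
    simp only [bigAnd, evalProp] at h
    simpa using ⟨h.1, ih h.2⟩

theorem isStatic_bigAnd {l : List (Form Pred Cons)} (h : ∀ φ ∈ l, φ.isStatic) :
    (bigAnd l).isStatic := by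
  induction l with
  | nil => simp [bigAnd, trueF, falseF, isStatic]
  | cons φ l ih =>
    simp only [List.mem_cons, forall_eq_or_imp] at h
    exact ⟨h.1, ih h.2⟩

theorem isStatic_bigOr {l : List (Form Pred Cons)} (h : ∀ φ ∈ l, φ.isStatic) :
    (bigOr l).isStatic := by
  induction l with
  | nil => simp [bigOr, falseF, isStatic]
  | cons φ l ih =>
    simp only [List.mem_cons, forall_eq_or_imp] at h
    exact ⟨h.1, ih h.2⟩

theorem isBase.isStatic {φ : Form Pred Cons} (h : φ.isBase) : φ.isStatic := by
  induction φ with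
  | neg φ ih => exact ih h
  | and φ ψ ihφ ihψ => exact ⟨ihφ h.1, ihψ h.2⟩
  | _ => simp_all [isBase, Form.isStatic]

theorem isBase.replace [DecidableEq Cons] {φ : Form Pred Cons} (h : φ.isBase)
    (s t : Term Cons) : (φ.replace s t).isBase := by
  induction φ with
  | neg φ ih => exact ih h
  | and φ ψ ihφ ihψ => exact ⟨ihφ h.1, ihψ h.2⟩
  | _ => simp_all [isBase, Form.replace]

theorem termList_replace [DecidableEq Cons] (φ : Form Pred Cons) (s t : Term Cons) :
    (φ.replace s t).termList = φ.termList.map (Term.repl s t) := by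
  induction φ <;> simp_all [termList, Form.replace]

theorem replace_eq_self [DecidableEq Cons] {φ : Form Pred Cons} (s : Term Cons)
    {t : Term Cons} (h : t ∉ φ.termList) : φ.replace s t = φ := by
  induction φ with
  | pred P args =>
    simp only [Form.replace, pred.injEq, true_and]
    refine (List.map_congr_left fun u hu => ?_).trans args.map_id
    exact if_neg (ne_of_mem_of_not_mem hu h)
  | _ => grind [termList, Form.replace, Term.repl]

theorem mem_termList_replace_const [DecidableEq Cons] {φ : Form Pred Cons} {c : Cons}
    {t u : Term Cons} (h : u ∈ (φ.replace (.const c) t).termList) :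
    u = .const c ∨ (u ∈ φ.termList ∧ u ≠ t) := by
  rw [termList_replace, List.mem_map] at h
  obtain ⟨w, hw, rfl⟩ := h
  unfold Term.repl
  split_ifs with hwt
  · exact .inl rfl
  · exact .inr ⟨hw, hwt⟩

end Form

namespace MCS

variable {Pred Cons : Type} [Fintype Cons] [DecidableEq Cons] {k : ℕ}
  {Δ : Set (Form Pred Cons)}

theorem exists_evalProp (h : MCS k Δ) {l : List (Form Pred Cons)} (hl : ∀ φ ∈ l, φ ∈ Δ)
    {χ : Form Pred Cons} (hχ : χ.isStatic) (hp : Prov k χ) :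
    ∃ v, Form.evalProp v χ ∧ ∀ φ ∈ l, Form.evalProp v φ := by
  by_contra! hv
  refine h.1 ⟨l, hl, .mp (.taut (φ := χ.imp ((Form.bigAnd l).imp Form.falseF)) ?_ ?_) hp⟩
  · exact ⟨hχ, Form.isStatic_bigAnd fun φ hφ => h.2.1 φ (hl φ hφ), trivial⟩
  · intro v
    simp only [Form.imp, Form.evalProp]
    rintro ⟨h₁, h₂⟩
    obtain ⟨φ, hφ, hn⟩ := hv v h₁
    exact h₂ fun h₃ => hn (Form.evalProp_bigAnd h₃.1 φ hφ)

/-- An MCS contains the propositional consequences of its members and one theorem. -/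
theorem mem_of_prov (h : MCS k Δ) {l : List (Form Pred Cons)} (hl : ∀ φ ∈ l, φ ∈ Δ)
    {χ ψ : Form Pred Cons} (hχ : χ.isStatic) (hp : Prov k χ) (hψ : ψ.isStatic)
    (himp : ∀ v, Form.evalProp v χ → (∀ φ ∈ l, Form.evalProp v φ) → Form.evalProp v ψ) :
    ψ ∈ Δ := by
  refine (h.2.2 ψ hψ).resolve_right fun hn => ?_
  obtain ⟨v, hv, hvl⟩ := h.exists_evalProp (l := ψ.neg :: l) (by simpa using ⟨hn, hl⟩) hχ hp
  simp only [List.mem_cons, forall_eq_or_imp, Form.evalProp] at hvl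
  exact hvl.1 (himp v hv hvl.2)

theorem falseF_notMem (h : MCS k Δ) : Form.falseF ∉ Δ := by
  intro hf
  obtain ⟨v, hv, hvl⟩ := h.exists_evalProp (l := [Form.falseF]) (by simpa using hf)
    (χ := .eq (.var .x) (.var .x)) trivial (.eqRefl _)
  simp only [List.mem_singleton, forall_eq, Form.falseF, Form.evalProp] at hv hvl
  exact hvl hv

theorem exists_mem_of_bigOr_mem (h : MCS k Δ) {l : List (Form Pred Cons)}
    (hl : ∀ φ ∈ l, φ.isStatic) (hm : Form.bigOr l ∈ Δ) : ∃ φ ∈ l, φ ∈ Δ := by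
  induction l with
  | nil => exact (h.falseF_notMem hm).elim
  | cons φ l ih =>
    simp only [List.mem_cons, forall_eq_or_imp] at hl
    rcases h.2.2 φ hl.1 with hφ | hφ
    · exact ⟨φ, by simp, hφ⟩
    · obtain ⟨ψ, hψ, hψΔ⟩ := ih hl.2 <|
        h.mem_of_prov (l := [φ.neg, Form.bigOr (φ :: l)]) (by simpa using ⟨hφ, hm⟩)
          (χ := .eq (.var .x) (.var .x)) trivial (.eqRefl _) (Form.isStatic_bigOr hl.2)
          fun v _ hv => by
            simp only [List.mem_cons, List.not_mem_nil, or_false, forall_eq_or_imp, forall_eq,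
              Form.bigOr, Form.or, Form.evalProp] at hv
            tauto
      exact ⟨ψ, by simp [hψ], hψΔ⟩

theorem exists_var_eq_const (h : MCS k Δ) (z : Var) :
    ∃ c : Cons, Form.eq (.var z) (.const c) ∈ Δ := by
  have hs : ∀ φ ∈ (Finset.univ : Finset Cons).toList.map fun c =>
      (Form.eq (.var z) (.const c) : Form Pred Cons), φ.isStatic := by
    simp [Form.isStatic]
  obtain ⟨φ, hφ, hφΔ⟩ := h.exists_mem_of_bigOr_mem hs <|
    h.mem_of_prov (l := []) (by simp) (Form.isStatic_bigOr hs) (.atSomewhere z)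
      (Form.isStatic_bigOr hs) fun _ hv _ => hv
  obtain ⟨c, -, rfl⟩ := List.mem_map.1 hφ
  exact ⟨c, hφΔ⟩

theorem mem_iff_replace_mem (h : MCS k Δ) {α : Form Pred Cons} (hα : α.isBase)
    {s t : Term Cons} (hst : Form.eq t s ∈ Δ) : α ∈ Δ ↔ α.replace s t ∈ Δ := by
  have hα' := hα.replace s t
  have heq : Form.eq s t ∈ Δ :=
    h.mem_of_prov (l := [Form.eq t s]) (by simpa using hst) (χ := (Form.eq t s).imp (.eq s t))
      ⟨trivial, trivial⟩ (.eqSymm t s) trivial fun v hv hvl => by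
        simp only [List.mem_singleton, forall_eq, Form.imp, Form.evalProp] at hv hvl ⊢
        tauto
  have hstat : ((Form.eq s t).imp (α.iffF (α.replace s t))).isStatic :=
    ⟨trivial, ⟨hα.isStatic, hα'.isStatic⟩, hα'.isStatic, hα.isStatic⟩
  constructor
  all_goals
    intro hm
    refine h.mem_of_prov (l := [Form.eq s t, _]) (by simpa using ⟨heq, hm⟩) hstat
      (.eqSubst s t hα) (by first | exact hα'.isStatic | exact hα.isStatic) fun v hv hvl => ?_
    simp only [List.mem_cons, List.not_mem_nil, or_false, forall_eq_or_imp, forall_eq,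
      Form.imp, Form.iffF, Form.evalProp] at hv hvl ⊢
    tauto

/-- A variable whose value two MCSs agree on can be replaced by one constant in both. -/
theorem exists_replace_const {Δ₁ Δ₂ : Set (Form Pred Cons)} (h₁ : MCS k Δ₁) (h₂ : MCS k Δ₂)
    {α : Form Pred Cons} (hα : α.isBase) (z : Var)
    (hz : .var z ∈ α.termList → ∀ c : Cons,
      (Form.eq (.var z) (.const c) ∈ Δ₁ ↔ Form.eq (.var z) (.const c) ∈ Δ₂)) :
    ∃ c : Cons, (α ∈ Δ₁ ↔ α.replace (.const c) (.var z) ∈ Δ₁) ∧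
      (α ∈ Δ₂ ↔ α.replace (.const c) (.var z) ∈ Δ₂) := by
  obtain ⟨c, hc⟩ := h₁.exists_var_eq_const z
  refine ⟨c, h₁.mem_iff_replace_mem hα hc, ?_⟩
  by_cases hm : .var z ∈ α.termList
  · exact h₂.mem_iff_replace_mem hα ((hz hm c).1 hc)
  · rw [Form.replace_eq_self _ hm]

end MCS

/-- If two MCSs agree on all `L_B`-formulas over constants and
agree on the values of all terms in `T`, then they contain the same `L_B`-formulas
whose terms are among `T`. -/
theorem mcs_term_agreement {Pred Cons : Type} [Fintype Cons] [DecidableEq Cons]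
    [Nonempty Cons] (k : ℕ) (T : Set (Term Cons)) (Δ₁ Δ₂ : Set (Form Pred Cons))
    (h₁ : MCS k Δ₁) (h₂ : MCS k Δ₂) (hc : consEq Δ₁ Δ₂)
    (hT : ∀ t ∈ T, ∀ c : Cons,
      (Form.eq t (Term.const c) ∈ Δ₁ ↔ Form.eq t (Term.const c) ∈ Δ₂))
    (α : Form Pred Cons) (hα : α.isBase) (hterm : ∀ t ∈ α.termList, t ∈ T) :
    α ∈ Δ₁ ↔ α ∈ Δ₂ := by
  obtain ⟨a, ha₁, ha₂⟩ := h₁.exists_replace_const h₂ hα .x fun hx => hT _ (hterm _ hx)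
  obtain ⟨b, hb₁, hb₂⟩ := h₁.exists_replace_const h₂ (hα.replace (.const a) (.var .x)) .y
    fun hy => hT _ <| hterm _ <| by
      rcases Form.mem_termList_replace_const hy with h | h
      · cases h
      · exact h.1
  rw [ha₁, ha₂, hb₁, hb₂]
  refine hc _ ((hα.replace _ _).replace _ _) fun t ht => ?_
  rcases Form.mem_termList_replace_const ht with h | ⟨h, hy⟩
  · exact ⟨b, h⟩
  rcases Form.mem_termList_replace_const h with h | ⟨-, hx⟩
  · exact ⟨a, h⟩
  match t with
  | .const c => exact ⟨c, rfl⟩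
  | .var .x => exact (hx rfl).elim
  | .var .y => exact (hy rfl).elim
end
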